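/- arXiv:1909.08781 — 12 statements merged into one kernel-verified Lean document; each statement's English description precedes it below -/
import Mathlib

section
/- Let β > 0, 0 < σ̲ < 1, and ρ > 0. Then there exists a unique R ∈ (ρ, ∞) satisfying (k1(ρ)i1(R) − i1(ρ)k1(R)) + β(k1(ρ)i0(R) + i1(ρ)k0(R)) = πβ/(2σ̲ρ²); moreover, for this R, the number σ̃ := (3R²/(R³ − ρ³))·(2σ̲ρ²/π)·(k1(ρ)i1(R) − i1(ρ)k1(R)) satisfies σ̲ < σ̃ < σ_s(R) < 1, where σ_s(R) := (2/π)σ̲ρ²(k1(ρ)i0(R) + i1(ρ)k0(R)). -/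
/-- Modified spherical Bessel function `i₀(s) = sinh s / s`. -/
noncomputable def i0 (s : ℝ) : ℝ := Real.sinh s / s

/-- Modified spherical Bessel function `i₁(s) = cosh s / s - sinh s / s²`. -/
noncomputable def i1 (s : ℝ) : ℝ := Real.cosh s / s - Real.sinh s / s ^ 2

/-- Modified spherical Bessel function `k₀(s) = (π/2) e^{-s} / s`. -/
noncomputable def k0 (s : ℝ) : ℝ := (Real.pi / 2) * Real.exp (-s) / s

/-- Modified spherical Bessel function `k₁(s) = (π/2) e^{-s} (1/s + 1/s²)`. -/
noncomputable def k1 (s : ℝ) : ℝ := (Real.pi / 2) * Real.exp (-s) * (1 / s + 1 / s ^ 2)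

noncomputable def auxA (ρ r : ℝ) : ℝ := ρ * Real.cosh (r - ρ) + Real.sinh (r - ρ)

noncomputable def auxB (ρ r : ℝ) : ℝ :=
  (r * ρ - 1) * Real.sinh (r - ρ) + (r - ρ) * Real.cosh (r - ρ)

lemma auxU (ρ r : ℝ) (hρ : 0 < ρ) (hr : 0 < r) :
    k1 ρ * i0 r + i1 ρ * k0 r = Real.pi / (2 * ρ ^ 2) * (auxA ρ r / r) := by
  have e1 : Real.exp (-ρ) = Real.cosh ρ - Real.sinh ρ := (Real.cosh_sub_sinh ρ).symm
  have e2 : Real.exp (-r) = Real.cosh r - Real.sinh r := (Real.cosh_sub_sinh r).symm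
  unfold k1 i0 i1 k0 auxA
  rw [e1, e2, Real.cosh_sub, Real.sinh_sub]
  field_simp
  ring

lemma auxV (ρ r : ℝ) (hρ : 0 < ρ) (hr : 0 < r) :
    k1 ρ * i1 r - i1 ρ * k1 r = Real.pi / (2 * ρ ^ 2) * (auxB ρ r / r ^ 2) := by
  have e1 : Real.exp (-ρ) = Real.cosh ρ - Real.sinh ρ := (Real.cosh_sub_sinh ρ).symm
  have e2 : Real.exp (-r) = Real.cosh r - Real.sinh r := (Real.cosh_sub_sinh r).symm
  unfold k1 i1 auxB
  rw [e1, e2, Real.cosh_sub, Real.sinh_sub]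
  field_simp
  ring

lemma auxA_deriv (ρ r : ℝ) :
    HasDerivAt (auxA ρ) (ρ * Real.sinh (r - ρ) + Real.cosh (r - ρ)) r := by
  have h := (hasDerivAt_id r).sub_const ρ
  have := (h.cosh.const_mul ρ).add h.sinh
  refine HasDerivAt.congr_deriv (f := _) this ?_
  simp

lemma auxB_deriv (ρ r : ℝ) : HasDerivAt (auxB ρ) (r * auxA ρ r) r := by
  have h := (hasDerivAt_id r).sub_const ρ
  have := ((((hasDerivAt_id r).mul_const ρ).sub_const 1).mul h.sinh).add (h.mul h.cosh)
  refine HasDerivAt.congr_deriv (f := _) this ?_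
  simp [auxA]
  ring

lemma auxU_deriv (ρ r : ℝ) (hr : 0 < r) :
    HasDerivAt (fun r => auxA ρ r / r) (auxB ρ r / r ^ 2) r := by
  have := (auxA_deriv ρ r).div (hasDerivAt_id r) hr.ne'
  refine HasDerivAt.congr_deriv (f := _) this ?_
  simp [auxA, auxB]
  ring

lemma auxV_deriv (ρ r : ℝ) (hr : 0 < r) :
    HasDerivAt (fun r => auxB ρ r / r ^ 2) ((r ^ 2 * auxA ρ r - 2 * auxB ρ r) / r ^ 3) r := by
  have := (auxB_deriv ρ r).div (hasDerivAt_pow 2 r) (pow_pos hr 2).ne'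
  refine HasDerivAt.congr_deriv (f := _) this ?_
  field_simp
  simp
  ring

lemma aux_mono (ρ : ℝ) (f f' : ℝ → ℝ) (hf : ∀ r, ρ ≤ r → HasDerivAt f (f' r) r)
    (hp : ∀ r, ρ < r → 0 < f' r) : StrictMonoOn f (Set.Ici ρ) := by
  apply strictMonoOn_of_deriv_pos (convex_Ici ρ)
  · intro x hx
    exact (hf x hx).continuousAt.continuousWithinAt
  · intro x hx
    rw [interior_Ici] at hx
    rw [(hf x (le_of_lt hx)).deriv]
    exact hp x hx

lemma auxA_gt (ρ r : ℝ) (hρ : 0 < ρ) (hr : ρ < r) : r < auxA ρ r := by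
  have h1 : r - ρ < Real.sinh (r - ρ) := Real.self_lt_sinh_iff.2 (by linarith)
  have h2 : 1 ≤ Real.cosh (r - ρ) := Real.one_le_cosh _
  unfold auxA
  nlinarith

lemma auxB_gt (ρ r : ℝ) (hρ : 0 < ρ) (hr : ρ < r) : r ^ 3 - ρ ^ 3 < 3 * auxB ρ r := by
  have := aux_mono ρ (fun r => 3 * auxB ρ r - r ^ 3) (fun r => 3 * (r * auxA ρ r) - 3 * r ^ 2)
    (fun r _ => by
      have := ((auxB_deriv ρ r).const_mul 3).sub (hasDerivAt_pow 3 r)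
      refine HasDerivAt.congr_deriv (f := _) this ?_
      norm_num)
    (fun r hr => by
      have := auxA_gt ρ r hρ hr
      nlinarith)
  have := this (Set.mem_Ici.2 le_rfl) (Set.mem_Ici.2 hr.le) hr
  simp [auxB] at this
  simp only [auxB]
  linarith

lemma cube_lt (ρ r : ℝ) (hρ : 0 < ρ) (hr : ρ < r) : 0 < r ^ 3 - ρ ^ 3 := by
  have := pow_lt_pow_left₀ hr hρ.le (n := 3) (by norm_num)
  linarith

lemma auxB_pos (ρ r : ℝ) (hρ : 0 < ρ) (hr : ρ < r) : 0 < auxB ρ r := by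
  have := auxB_gt ρ r hρ hr
  have := cube_lt ρ r hρ hr
  linarith

lemma auxAB (ρ r : ℝ) (hρ : 0 < ρ) (hr : ρ < r) :
    3 * auxB ρ r < auxA ρ r / r * (r ^ 3 - ρ ^ 3) := by
  have := aux_mono ρ (fun r => auxA ρ r / r * (r ^ 3 - ρ ^ 3) - 3 * auxB ρ r)
    (fun r => auxB ρ r / r ^ 2 * (r ^ 3 - ρ ^ 3))
    (fun r h => by
      have h0 : 0 < r := by linarith
      have := ((auxU_deriv ρ r h0).mul ((hasDerivAt_pow 3 r).sub_const (ρ ^ 3))).sub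
        ((auxB_deriv ρ r).const_mul 3)
      refine HasDerivAt.congr_deriv (f := _) this ?_
      field_simp
      norm_num
      ring)
    (fun r hr => by
      have h0 : 0 < r := by linarith
      have := auxB_pos ρ r hρ hr
      have := cube_lt ρ r hρ hr
      positivity)
  have := this (Set.mem_Ici.2 le_rfl) (Set.mem_Ici.2 hr.le) hr
  have e : auxB ρ ρ = 0 := by simp [auxB]
  simp only [e] at this
  linarith

lemma auxF_mono (β ρ : ℝ) (hβ : 0 < β) (hρ : 0 < ρ) :
    StrictMonoOn (fun r => auxB ρ r / r ^ 2 + β * (auxA ρ r / r)) (Set.Ici ρ) := by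
  apply aux_mono ρ _ (fun r => (r ^ 2 * auxA ρ r - 2 * auxB ρ r) / r ^ 3
    + β * (auxB ρ r / r ^ 2))
  · intro r h
    have h0 : 0 < r := by linarith
    exact (auxV_deriv ρ r h0).add ((auxU_deriv ρ r h0).const_mul β)
  · intro r hr
    have h0 : 0 < r := by linarith
    have hB := auxB_pos ρ r hρ hr
    have hA := auxA_gt ρ r hρ hr
    have h := auxAB ρ r hρ hr
    have h2 : auxA ρ r / r * (r ^ 3 - ρ ^ 3) ≤ r ^ 2 * auxA ρ r := by
      have : r ^ 2 * auxA ρ r = auxA ρ r / r * r ^ 3 := by field_simp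
      rw [this]
      have : 0 < auxA ρ r / r := div_pos (by linarith) h0
      have : 0 < ρ ^ 3 := by positivity
      gcongr
      linarith
    have : 0 < r ^ 2 * auxA ρ r - 2 * auxB ρ r := by linarith
    positivity

lemma auxF_cont (β ρ : ℝ) (hρ : 0 < ρ) :
    ContinuousOn (fun r => auxB ρ r / r ^ 2 + β * (auxA ρ r / r)) (Set.Ici ρ) := by
  intro r h
  have h0 : 0 < r := lt_of_lt_of_le hρ h
  exact ((auxV_deriv ρ r h0).add
    ((auxU_deriv ρ r h0).const_mul β)).continuousAt.continuousWithinAt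

lemma auxF_exists (β σl ρ : ℝ) (hβ : 0 < β) (hσ0 : 0 < σl) (hσ1 : σl < 1) (hρ : 0 < ρ) :
    ∃ r, ρ < r ∧ auxB ρ r / r ^ 2 + β * (auxA ρ r / r) = β / σl := by
  obtain ⟨d, hd⟩ : ∃ d, d = ρ + 8 / (ρ * σl) := ⟨_, rfl⟩
  have hq : 0 < 8 / (ρ * σl) := by positivity
  have hd0 : 0 < d := by linarith
  have hdρ : ρ ≤ d := by linarith
  have hlow : auxB ρ ρ / ρ ^ 2 + β * (auxA ρ ρ / ρ) < β / σl := by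
    simp [auxB, auxA, hρ.ne']
    rw [lt_div_iff₀ hσ0]
    nlinarith
  have hhigh : β / σl ≤ auxB ρ (ρ + d) / (ρ + d) ^ 2 + β * (auxA ρ (ρ + d) / (ρ + d)) := by
    have hB := auxB_pos ρ (ρ + d) hρ (by linarith)
    have h1 : 0 ≤ auxB ρ (ρ + d) / (ρ + d) ^ 2 := by positivity
    have h2 : 1 / σl ≤ auxA ρ (ρ + d) / (ρ + d) := by
      rw [le_div_iff₀ (by positivity)]
      have hs : 0 < Real.sinh d := Real.sinh_pos_iff.2 hd0
      have he := Real.quadratic_le_exp_of_nonneg hd0.le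
      have hc : d ^ 2 / 4 ≤ Real.cosh d := by
        rw [Real.cosh_eq]
        have := Real.exp_pos (-d)
        nlinarith
      have hA : auxA ρ (ρ + d) = ρ * Real.cosh d + Real.sinh d := by simp [auxA]
      rw [hA]
      have h3 : 1 / σl ≤ ρ * d / 8 := by
        have : 1 / σl = ρ * (8 / (ρ * σl)) / 8 := by field_simp
        rw [this]
        gcongr
        linarith
      calc 1 / σl * (ρ + d) ≤ ρ * d / 8 * (d + d) := by gcongr
        _ = ρ * (d ^ 2 / 4) := by ring
        _ ≤ ρ * Real.cosh d := by gcongr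
        _ ≤ _ := by linarith
    calc β / σl = β * (1 / σl) := by ring
      _ ≤ β * (auxA ρ (ρ + d) / (ρ + d)) := by gcongr
      _ ≤ _ := by linarith
  have hI := intermediate_value_Icc (show ρ ≤ ρ + d by linarith)
    ((auxF_cont β ρ hρ).mono Set.Icc_subset_Ici_self)
  obtain ⟨r, hr, hre⟩ := hI ⟨hlow.le, hhigh⟩
  refine ⟨r, lt_of_le_of_ne hr.1 ?_, hre⟩
  rintro rfl
  exact hlow.ne hre

lemma aux_eq (β σl ρ r : ℝ) (hσ0 : 0 < σl) (hρ : 0 < ρ) (hr : ρ < r) :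
    ((k1 ρ * i1 r - i1 ρ * k1 r) + β * (k1 ρ * i0 r + i1 ρ * k0 r)
        = Real.pi * β / (2 * σl * ρ ^ 2)) ↔
      auxB ρ r / r ^ 2 + β * (auxA ρ r / r) = β / σl := by
  have h0 : 0 < r := by linarith
  rw [auxU ρ r hρ h0, auxV ρ r hρ h0]
  have hpi := Real.pi_pos
  have hc : Real.pi / (2 * ρ ^ 2) ≠ 0 := by positivity
  have e1 : Real.pi * β / (2 * σl * ρ ^ 2) = Real.pi / (2 * ρ ^ 2) * (β / σl) := by
    field_simp
  rw [e1, ← mul_right_inj' hc (b := auxB ρ r / r ^ 2 + β * (auxA ρ r / r))]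
  rw [mul_add, mul_left_comm β]

/-- For β > 0, 0 < σ̲ < 1, ρ > 0, there is a unique R ∈ (ρ,∞) solving the
stationarity equation, and for this R the number σ̃ satisfies σ̲ < σ̃ < σ_s(R) < 1. -/
theorem stmt_0 (β σl ρ : ℝ) (hβ : 0 < β) (hσ0 : 0 < σl) (hσ1 : σl < 1) (hρ : 0 < ρ) :
    (∃! R : ℝ, R ∈ Set.Ioi ρ ∧
      (k1 ρ * i1 R - i1 ρ * k1 R) + β * (k1 ρ * i0 R + i1 ρ * k0 R)
        = Real.pi * β / (2 * σl * ρ ^ 2)) ∧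
    (∀ R : ℝ, R ∈ Set.Ioi ρ →
      (k1 ρ * i1 R - i1 ρ * k1 R) + β * (k1 ρ * i0 R + i1 ρ * k0 R)
        = Real.pi * β / (2 * σl * ρ ^ 2) →
      σl < (3 * R ^ 2 / (R ^ 3 - ρ ^ 3)) * (2 * σl * ρ ^ 2 / Real.pi)
            * (k1 ρ * i1 R - i1 ρ * k1 R) ∧
      (3 * R ^ 2 / (R ^ 3 - ρ ^ 3)) * (2 * σl * ρ ^ 2 / Real.pi)
            * (k1 ρ * i1 R - i1 ρ * k1 R)
        < (2 / Real.pi) * σl * ρ ^ 2 * (k1 ρ * i0 R + i1 ρ * k0 R) ∧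
      (2 / Real.pi) * σl * ρ ^ 2 * (k1 ρ * i0 R + i1 ρ * k0 R) < 1) := by
  refine ⟨?_, ?_⟩
  · obtain ⟨r, hr, he⟩ := auxF_exists β σl ρ hβ hσ0 hσ1 hρ
    refine ⟨r, ⟨hr, (aux_eq β σl ρ r hσ0 hρ hr).2 he⟩, ?_⟩
    rintro y ⟨hy, hye⟩
    have hye := (aux_eq β σl ρ y hσ0 hρ hy).1 hye
    exact (auxF_mono β ρ hβ hρ).injOn (Set.mem_Ici.2 (le_of_lt hy)) (Set.mem_Ici.2 hr.le)
      (hye.trans he.symm)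
  · intro R hR hE
    have hR : ρ < R := hR
    have h0 : 0 < R := by linarith
    have hE := (aux_eq β σl ρ R hσ0 hρ hR).1 hE
    rw [auxU ρ R hρ h0, auxV ρ R hρ h0]
    have hpi := Real.pi_pos
    have hc := cube_lt ρ R hρ hR
    have e1 : (3 * R ^ 2 / (R ^ 3 - ρ ^ 3)) * (2 * σl * ρ ^ 2 / Real.pi)
            * (Real.pi / (2 * ρ ^ 2) * (auxB ρ R / R ^ 2))
          = σl * (3 * auxB ρ R / (R ^ 3 - ρ ^ 3)) := by
      field_simp
    have e2 : (2 / Real.pi) * σl * ρ ^ 2 * (Real.pi / (2 * ρ ^ 2) * (auxA ρ R / R))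
          = σl * (auxA ρ R / R) := by
      field_simp
    rw [e1, e2]
    refine ⟨?_, ?_, ?_⟩
    · have : 1 < 3 * auxB ρ R / (R ^ 3 - ρ ^ 3) := by
        rw [lt_div_iff₀ hc]
        linarith [auxB_gt ρ R hρ hR]
      nlinarith
    · apply mul_lt_mul_of_pos_left _ hσ0
      rw [div_lt_iff₀ hc]
      exact auxAB ρ R hρ hR
    · have hB : 0 < auxB ρ R / R ^ 2 := div_pos (auxB_pos ρ R hρ hR) (by positivity)
      have h1 : β * (auxA ρ R / R) < β * (1 / σl) := by
        rw [mul_one_div]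
        linarith
      have h2 := lt_of_mul_lt_mul_left h1 hβ.le
      rw [lt_div_iff₀ hσ0] at h2
      linarith
end

section
/- Let β > 0, 0 < σ̲ < 1, and ρ > 0. Define f(s) = (k1(ρ)i1(s) − i1(ρ)k1(s)) + β(k1(ρ)i0(s) + i1(ρ)k0(s)) − πβ/(2σ̲ρ²) for s ≥ ρ. Then f(ρ) = (πβ/(2ρ²))(1 − 1/σ̲) < 0, f is strictly increasing on (ρ, ∞), and f(s) → +∞ as s → +∞. -/
open Set in
lemma aux_psi {s : ℝ} (hs : 0 < s) : 0 < s * Real.cosh s - Real.sinh s := by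
  have h : StrictMonoOn (fun s : ℝ => s * Real.cosh s - Real.sinh s) (Ici 0) := by
    apply strictMonoOn_of_hasDerivWithinAt_pos (convex_Ici 0) (f' := fun s => s * Real.sinh s)
    · exact Continuous.continuousOn (by fun_prop)
    · intro x hx
      have := ((hasDerivAt_id x).mul (Real.hasDerivAt_cosh x)).sub (Real.hasDerivAt_sinh x)
      refine (this.congr_deriv ?_).hasDerivWithinAt
      simp
    · intro x hx
      rw [interior_Ici] at hx
      exact mul_pos hx (Real.sinh_pos_iff.2 hx)
  simpa using h (mem_Ici.2 le_rfl) (mem_Ici.2 hs.le) hs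

open Set in
lemma aux_phi {s : ℝ} (hs : 0 < s) :
    0 < s ^ 2 * Real.sinh s - 2 * (s * Real.cosh s - Real.sinh s) := by
  have h : StrictMonoOn (fun s : ℝ => s ^ 2 * Real.sinh s - 2 * (s * Real.cosh s - Real.sinh s))
      (Ici 0) := by
    apply strictMonoOn_of_hasDerivWithinAt_pos (convex_Ici 0) (f' := fun s => s ^ 2 * Real.cosh s)
    · exact Continuous.continuousOn (by fun_prop)
    · intro x hx
      have := (((hasDerivAt_pow 2 x)).mul (Real.hasDerivAt_sinh x)).sub
        ((((hasDerivAt_id x).mul (Real.hasDerivAt_cosh x)).sub (Real.hasDerivAt_sinh x)).const_mul 2)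
      refine (this.congr_deriv ?_).hasDerivWithinAt
      simp
      ring
    · intro x hx
      rw [interior_Ici] at hx
      exact mul_pos (pow_pos hx 2) (Real.cosh_pos x)
  simpa using h (mem_Ici.2 le_rfl) (mem_Ici.2 hs.le) hs

lemma i1_eq {s : ℝ} (hs : 0 < s) : i1 s = (s * Real.cosh s - Real.sinh s) / s ^ 2 := by
  unfold i1; field_simp

lemma i1_pos {s : ℝ} (hs : 0 < s) : 0 < i1 s := by
  rw [i1_eq hs]; exact div_pos (aux_psi hs) (pow_pos hs 2)

lemma k1_pos {s : ℝ} (hs : 0 < s) : 0 < k1 s := by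
  unfold k1; positivity

lemma k0_pos {s : ℝ} (hs : 0 < s) : 0 < k0 s := by
  unfold k0; positivity

lemma i0_pos {s : ℝ} (hs : 0 < s) : 0 < i0 s := div_pos (Real.sinh_pos_iff.2 hs) hs

lemma i0_deriv {s : ℝ} (hs : 0 < s) : HasDerivAt i0 (i1 s) s := by
  have := (Real.hasDerivAt_sinh s).div (hasDerivAt_id s) hs.ne'
  refine this.congr_deriv ?_
  rw [i1_eq hs]; simp; ring

lemma k0_deriv {s : ℝ} (hs : 0 < s) : HasDerivAt k0 (-k1 s) s := by
  have := (((hasDerivAt_neg s).exp).const_mul (Real.pi / 2)).div (hasDerivAt_id s) hs.ne'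
  refine this.congr_deriv ?_
  unfold k1; simp; field_simp; ring

open Set in
lemma i1_mono : StrictMonoOn i1 (Ioi 0) := by
  have key : ∀ s : ℝ, 0 < s → HasDerivAt i1
      ((s ^ 2 * Real.sinh s - 2 * (s * Real.cosh s - Real.sinh s)) / s ^ 3) s := by
    intro s hs
    have := ((Real.hasDerivAt_cosh s).div (hasDerivAt_id s) hs.ne').sub
      ((Real.hasDerivAt_sinh s).div (hasDerivAt_pow 2 s) (pow_pos hs 2).ne')
    refine this.congr_deriv ?_
    simp; field_simp; ring
  apply strictMonoOn_of_hasDerivWithinAt_pos (convex_Ioi 0)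
    (f' := fun s => (s ^ 2 * Real.sinh s - 2 * (s * Real.cosh s - Real.sinh s)) / s ^ 3)
  · exact fun x hx => (key x hx).continuousAt.continuousWithinAt
  · intro x hx
    rw [interior_Ioi] at hx
    exact (key x hx).hasDerivWithinAt
  · intro x hx
    rw [interior_Ioi] at hx
    exact div_pos (aux_phi hx) (pow_pos hx 3)

lemma k1_anti {a b : ℝ} (ha : 0 < a) (hab : a < b) : k1 b < k1 a := by
  have hb := ha.trans hab
  unfold k1
  have h1 : Real.exp (-b) < Real.exp (-a) := Real.exp_lt_exp.2 (by linarith)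
  have h2 : 1 / b < 1 / a := one_div_lt_one_div_of_lt ha hab
  have h3 : 1 / b ^ 2 < 1 / a ^ 2 :=
    one_div_lt_one_div_of_lt (by positivity) (by nlinarith)
  have hp := Real.pi_pos
  apply mul_lt_mul'' _ (by linarith) (by positivity) (by positivity)
  exact mul_lt_mul_of_pos_left h1 (by positivity)

lemma i1_ge {s : ℝ} (hs : 2 ≤ s) : s / 8 ≤ i1 s := by
  have h0 : 0 < s := by linarith
  rw [i1_eq h0, le_div_iff₀ (by positivity)]
  have h1 := (Real.sinh_lt_cosh s).le
  have h2 : s ^ 2 / 2 ≤ Real.exp s := by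
    simpa using Real.pow_div_factorial_le_exp s h0.le 2
  have h3 : Real.exp s / 2 ≤ Real.cosh s := by
    rw [Real.cosh_eq]; have := Real.exp_pos (-s); linarith
  have h4 : s ^ 2 / 4 ≤ Real.cosh s := by linarith
  have h5 : s ^ 2 / 4 * (s / 2) ≤ Real.cosh s * (s - 1) :=
    mul_le_mul h4 (by linarith) (by positivity) (by positivity)
  nlinarith

theorem stmt_1 (β σl ρ : ℝ) (hβ : 0 < β) (hσ0 : 0 < σl) (hσ1 : σl < 1) (hρ : 0 < ρ) :
    let f : ℝ → ℝ := fun s => (k1 ρ * i1 s - i1 ρ * k1 s)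
      + β * (k1 ρ * i0 s + i1 ρ * k0 s) - Real.pi * β / (2 * σl * ρ ^ 2)
    f ρ = (Real.pi * β / (2 * ρ ^ 2)) * (1 - 1 / σl) ∧ f ρ < 0 ∧
    StrictMonoOn f (Set.Ioi ρ) ∧
    Filter.Tendsto f Filter.atTop Filter.atTop := by
  intro f
  have hK := k1_pos hρ
  have hI := i1_pos hρ
  have hpi := Real.pi_pos
  have hW : k1 ρ * i0 ρ + i1 ρ * k0 ρ = Real.pi / (2 * ρ ^ 2) := by
    have he : Real.exp (-ρ) * (Real.cosh ρ + Real.sinh ρ) = 1 := by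
      rw [Real.cosh_add_sinh, ← Real.exp_add]; simp
    have : k1 ρ * i0 ρ + i1 ρ * k0 ρ
        = Real.pi / (2 * ρ ^ 2) * (Real.exp (-ρ) * (Real.cosh ρ + Real.sinh ρ)) := by
      unfold k1 i0 i1 k0; field_simp; ring
    rw [this, he, mul_one]
  have h1 : f ρ = (Real.pi * β / (2 * ρ ^ 2)) * (1 - 1 / σl) := by
    simp only [f]
    rw [hW]; field_simp; ring
  refine ⟨h1, ?_, ?_, ?_⟩
  · rw [h1]
    apply mul_neg_of_pos_of_neg (by positivity)
    have := one_lt_one_div hσ0 hσ1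
    linarith
  · have hg : ∀ a b, 0 < a → a < b →
        k1 ρ * i1 a - i1 ρ * k1 a < k1 ρ * i1 b - i1 ρ * k1 b := by
      intro a b ha hab
      have e1 := mul_lt_mul_of_pos_left (i1_mono ha (ha.trans hab) hab) hK
      have e2 := mul_lt_mul_of_pos_left (k1_anti ha hab) hI
      linarith
    have hd : ∀ s, 0 < s → HasDerivAt (fun s => k1 ρ * i0 s + i1 ρ * k0 s)
        (k1 ρ * i1 s - i1 ρ * k1 s) s := by
      intro s hs
      refine (((i0_deriv hs).const_mul (k1 ρ)).add ((k0_deriv hs).const_mul (i1 ρ))).congr_deriv ?_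
      ring
    have hh : StrictMonoOn (fun s => k1 ρ * i0 s + i1 ρ * k0 s) (Set.Ioi ρ) := by
      apply strictMonoOn_of_hasDerivWithinAt_pos (convex_Ioi ρ)
        (f' := fun s => k1 ρ * i1 s - i1 ρ * k1 s)
      · exact fun x hx => (hd x (hρ.trans hx)).continuousAt.continuousWithinAt
      · intro x hx
        rw [interior_Ioi] at hx
        exact (hd x (hρ.trans hx)).hasDerivWithinAt
      · intro x hx
        rw [interior_Ioi] at hx
        have := hg ρ x hρ hx
        linarith
    intro a ha b hb hab
    have e1 := hg a b (hρ.trans ha) hab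
    have e2 := mul_lt_mul_of_pos_left (hh ha hb hab) hβ
    simp only [f]
    simp only at e2
    linarith
  · have ht : Filter.Tendsto (fun s : ℝ => (k1 ρ / 8) * s
        + (- (i1 ρ * k1 ρ) - Real.pi * β / (2 * σl * ρ ^ 2))) Filter.atTop Filter.atTop :=
      Filter.tendsto_atTop_add_const_right _ _
        (Filter.tendsto_id.const_mul_atTop (by positivity))
    refine Filter.tendsto_atTop_mono' _ ?_ ht
    filter_upwards [Filter.eventually_ge_atTop 2, Filter.eventually_gt_atTop ρ] with s h2 hs
    have hs0 : 0 < s := by linarith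
    have e1 := mul_le_mul_of_nonneg_left (i1_ge h2) hK.le
    have e2 := mul_lt_mul_of_pos_left (k1_anti hρ hs) hI
    have e3 : 0 < β * (k1 ρ * i0 s + i1 ρ * k0 s) := by
      have := i0_pos hs0
      have := k0_pos hs0
      positivity
    simp only [f]
    linarith
end

section
/- Let ρ > 0. Then for every s > ρ, 3(s − ρ)cosh(s − ρ) + 3(sρ − 1)sinh(s − ρ) − s³ + ρ³ > 0. -/
lemma aux_mono_s4 (t : ℝ) (ht : 0 ≤ t) : 0 ≤ 3 * (t * Real.cosh t - Real.sinh t) - t ^ 3 := by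
  have hd : ∀ x : ℝ, HasDerivAt (fun t : ℝ => 3 * (t * Real.cosh t - Real.sinh t) - t ^ 3)
      (3 * x * (Real.sinh x - x)) x := by
    intro x
    have h := ((((hasDerivAt_id x).mul (Real.hasDerivAt_cosh x)).sub
      (Real.hasDerivAt_sinh x)).const_mul 3).sub (hasDerivAt_pow 3 x)
    refine h.congr_deriv ?_
    simp
    ring
  have hm : MonotoneOn (fun t : ℝ => 3 * (t * Real.cosh t - Real.sinh t) - t ^ 3)
      (Set.Ici 0) := by
    apply monotoneOn_of_deriv_nonneg (convex_Ici 0)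
    · exact fun x _ => (hd x).continuousAt.continuousWithinAt
    · exact fun x _ => (hd x).differentiableAt.differentiableWithinAt
    · intro x hx
      rw [interior_Ici] at hx
      have hx0 : 0 < x := hx
      rw [(hd x).deriv]
      have := Real.self_le_sinh_iff.2 hx0.le
      exact mul_nonneg (by positivity) (by linarith)
  have := hm (Set.mem_Ici.2 le_rfl) (Set.mem_Ici.2 ht) ht
  simpa using this

/-- For ρ > 0 and s > ρ, 3(s−ρ)cosh(s−ρ) + 3(sρ−1)sinh(s−ρ) − s³ + ρ³ > 0. -/
theorem stmt_4 (ρ : ℝ) (hρ : 0 < ρ) (s : ℝ) (hs : ρ < s) :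
    3 * (s - ρ) * Real.cosh (s - ρ) + 3 * (s * ρ - 1) * Real.sinh (s - ρ)
      - s ^ 3 + ρ ^ 3 > 0 := by
  have ht : 0 < s - ρ := by linarith
  have h1 := aux_mono_s4 (s - ρ) ht.le
  have h2 := Real.self_lt_sinh_iff.2 ht
  have h3 : 0 < s * ρ * (Real.sinh (s - ρ) - (s - ρ)) :=
    mul_pos (mul_pos (by linarith) hρ) (by linarith)
  nlinarith [h1, h3]
end

section
/- Let ρ > 0. Then for every s > ρ, (ρ + 1)(s³ − 3s² + 3s − ρ³)e^{2(s − ρ)} + (ρ − 1)(s³ + 3s² + 3s − ρ³) > 0. -/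
open Real in
lemma aux_pos (f f' : ℝ → ℝ) (h0 : f 0 = 0) (hd : ∀ x, HasDerivAt f (f' x) x)
    (hp : ∀ x, 0 < x → 0 < f' x) (t : ℝ) (ht : 0 < t) : 0 < f t := by
  have h : StrictMonoOn f (Set.Ici 0) := by
    apply strictMonoOn_of_deriv_pos (convex_Ici 0)
    · exact fun x _ => (hd x).continuousAt.continuousWithinAt
    · intro x hx
      rw [interior_Ici] at hx
      rw [(hd x).deriv]
      exact hp x hx
  have := h (Set.mem_Ici.2 le_rfl) (Set.mem_Ici.2 ht.le) ht
  rwa [h0] at this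

lemma aux_h (t : ℝ) (ht : 0 < t) : 0 < t * Real.cosh t - Real.sinh t := by
  refine aux_pos (fun t => t * Real.cosh t - Real.sinh t) (fun t => t * Real.sinh t) (by simp)
    (fun x => ?_) (fun x hx => mul_pos hx (Real.sinh_pos_iff.2 hx)) t ht
  have := ((hasDerivAt_id x).mul (Real.hasDerivAt_cosh x)).sub (Real.hasDerivAt_sinh x) 
  exact this.congr_deriv (by simp)

lemma aux_k (t : ℝ) (ht : 0 < t) : 0 < (t ^ 2 + 3) * Real.sinh t - 3 * (t * Real.cosh t) := by
  refine aux_pos (fun t => (t ^ 2 + 3) * Real.sinh t - 3 * (t * Real.cosh t))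
    (fun t => t * (t * Real.cosh t - Real.sinh t)) (by simp)
    (fun x => ?_) (fun x hx => mul_pos hx (aux_h x hx)) t ht
  have := ((((hasDerivAt_pow 2 x).add_const 3).mul (Real.hasDerivAt_sinh x))).sub
    (((hasDerivAt_id x).mul (Real.hasDerivAt_cosh x)).const_mul 3) 
  exact this.congr_deriv (by simp; ring)

lemma aux_l (t : ℝ) (ht : 0 < t) :
    0 < (t ^ 3 - 3 * t) * Real.cosh t + 3 * Real.sinh t := by
  refine aux_pos (fun t => (t ^ 3 - 3 * t) * Real.cosh t + 3 * Real.sinh t)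
    (fun t => t * (3 * (t * Real.cosh t - Real.sinh t) + t ^ 2 * Real.sinh t)) (by simp)
    (fun x => ?_) (fun x hx => ?_) t ht
  · have := ((((hasDerivAt_pow 3 x).sub ((hasDerivAt_id x).const_mul 3)).mul
      (Real.hasDerivAt_cosh x))).add ((Real.hasDerivAt_sinh x).const_mul 3) 
    exact this.congr_deriv (by simp; ring)
  · have := aux_h x hx
    have := Real.sinh_pos_iff.2 hx
    positivity

/-- For ρ > 0 and s > ρ,
(ρ+1)(s³−3s²+3s−ρ³)e^{2(s−ρ)} + (ρ−1)(s³+3s²+3s−ρ³) > 0. -/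
theorem stmt_5 (ρ : ℝ) (hρ : 0 < ρ) (s : ℝ) (hs : ρ < s) :
    (ρ + 1) * (s ^ 3 - 3 * s ^ 2 + 3 * s - ρ ^ 3) * Real.exp (2 * (s - ρ))
      + (ρ - 1) * (s ^ 3 + 3 * s ^ 2 + 3 * s - ρ ^ 3) > 0 := by
  obtain ⟨t, rfl⟩ : ∃ t, s = ρ + t := ⟨s - ρ, by ring⟩
  have ht : 0 < t := by linarith
  have h := aux_h t ht
  have k := aux_k t ht
  have l := aux_l t ht
  have e1 : Real.exp (2 * (ρ + t - ρ)) = Real.exp t * (Real.cosh t + Real.sinh t) := by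
    rw [Real.cosh_add_sinh, ← Real.exp_add]; congr 1; ring
  have e2 : Real.exp t * (Real.cosh t - Real.sinh t) = 1 := by
    rw [Real.cosh_sub_sinh, ← Real.exp_add]; simp
  have key : 0 < 2 * Real.exp t * (t * ((t ^ 2 + 3) * Real.sinh t - 3 * (t * Real.cosh t))
      + ρ * ((t ^ 3 - 3 * t) * Real.cosh t + 3 * Real.sinh t)
      + 3 * ρ ^ 2 * t * (t * Real.cosh t - Real.sinh t)
      + 3 * ρ ^ 3 * (t * Real.cosh t - Real.sinh t)) := by
    have := Real.exp_pos t
    positivity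
  rw [e1]
  refine lt_of_lt_of_eq key ?_
  linear_combination ((ρ - 1) * ((ρ + t) ^ 3 + 3 * (ρ + t) ^ 2 + 3 * (ρ + t) - ρ ^ 3)) * e2
end

section
/- For all 0 < s < t, (t − s)cosh(t − s) + (ts − 1)sinh(t − s) > 0; equivalently, i1(t)k1(s) − i1(s)k1(t) > 0. -/
theorem aux_sinh_lt (x : ℝ) (hx : 0 < x) : Real.sinh x < x * Real.cosh x := by
  have hm : StrictMonoOn (fun y : ℝ => y * Real.cosh y - Real.sinh y) (Set.Ici 0) := by
    apply strictMonoOn_of_deriv_pos (convex_Ici 0)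
    · exact ((continuous_id.mul Real.continuous_cosh).sub Real.continuous_sinh).continuousOn
    · intro y hy
      rw [interior_Ici] at hy
      have hy' : 0 < y := hy
      have h : HasDerivAt (fun y : ℝ => y * Real.cosh y - Real.sinh y)
          (1 * Real.cosh y + y * Real.sinh y - Real.cosh y) y :=
        ((hasDerivAt_id y).mul (Real.hasDerivAt_cosh y)).sub (Real.hasDerivAt_sinh y)
      rw [h.deriv]
      have := mul_pos hy' (Real.sinh_pos_iff.mpr hy')
      linarith
  have h := hm (Set.mem_Ici.mpr le_rfl) (Set.mem_Ici.mpr hx.le) hx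
  simp at h
  exact h

/-- For 0 < s < t, (t−s)cosh(t−s) + (ts−1)sinh(t−s) > 0, equivalently
i₁(t)k₁(s) − i₁(s)k₁(t) > 0. -/
theorem stmt_6 (s t : ℝ) (hs : 0 < s) (hst : s < t) :
    (t - s) * Real.cosh (t - s) + (t * s - 1) * Real.sinh (t - s) > 0 ∧
    i1 t * k1 s - i1 s * k1 t > 0 := by
  have ht : 0 < t := hs.trans hst
  have h1 : (t - s) * Real.cosh (t - s) + (t * s - 1) * Real.sinh (t - s) > 0 := by
    have ha := aux_sinh_lt (t - s) (sub_pos.mpr hst)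
    have hb := mul_pos (mul_pos ht hs) (Real.sinh_pos_iff.mpr (sub_pos.mpr hst))
    linarith
  refine ⟨h1, ?_⟩
  have h2 : i1 t * k1 s - i1 s * k1 t = (Real.pi / 2) * (1 / (t ^ 2 * s ^ 2)) *
      ((t - s) * Real.cosh (t - s) + (t * s - 1) * Real.sinh (t - s)) := by
    have es : Real.exp (-s) = Real.cosh s - Real.sinh s := (Real.cosh_sub_sinh s).symm
    have et : Real.exp (-t) = Real.cosh t - Real.sinh t := (Real.cosh_sub_sinh t).symm
    unfold i1 k1
    rw [es, et, Real.cosh_sub, Real.sinh_sub]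
    field_simp
    ring
  rw [h2]
  have := Real.pi_pos
  positivity
end

section
/- Let 0 < ρ < R and σ̲ > 0, and define σ̃ = (3R²/(R³ − ρ³))·(2σ̲ρ²/π)·(k1(ρ)i1(R) − i1(ρ)k1(R)). Then σ̲ < σ̃. -/
theorem aux_cosh (t : ℝ) (ht : 0 < t) : t ^ 3 < 3 * (t * Real.cosh t - Real.sinh t) := by
  have hd : ∀ x : ℝ, HasDerivAt (fun x : ℝ => 3 * (x * Real.cosh x - Real.sinh x) - x ^ 3)
      (3 * ((1 * Real.cosh x + x * Real.sinh x) - Real.cosh x) - 3 * x ^ 2) x := by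
    intro x
    have h := ((((hasDerivAt_id x).mul (Real.hasDerivAt_cosh x)).sub
      (Real.hasDerivAt_sinh x)).const_mul 3).sub (hasDerivAt_pow 3 x)
    refine HasDerivAt.congr_deriv (f := fun x : ℝ => 3 * (x * Real.cosh x - Real.sinh x) - x ^ 3) h ?_
    simp
  have hm : StrictMonoOn (fun x : ℝ => 3 * (x * Real.cosh x - Real.sinh x) - x ^ 3)
      (Set.Ici 0) := by
    apply strictMonoOn_of_deriv_pos (convex_Ici 0)
    · exact fun x _ => (hd x).continuousAt.continuousWithinAt
    · intro x hx
      rw [interior_Ici] at hx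
      have hx : 0 < x := hx
      rw [(hd x).deriv]
      have := Real.self_lt_sinh_iff.2 hx
      nlinarith
  have := hm (Set.mem_Ici.2 le_rfl) (Set.mem_Ici.2 ht.le) ht
  simp at this
  linarith

theorem aux_id (ρ R : ℝ) (hρ : 0 < ρ) (hR : 0 < R) :
    k1 ρ * i1 R - i1 ρ * k1 R = (Real.pi / 2) / (ρ ^ 2 * R ^ 2) *
      ((ρ * R - 1) * Real.sinh (R - ρ) + (R - ρ) * Real.cosh (R - ρ)) := by
  unfold k1 i1
  rw [Real.sinh_sub, Real.cosh_sub, ← Real.cosh_sub_sinh ρ, ← Real.cosh_sub_sinh R]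
  field_simp
  ring

/-- For 0 < ρ < R and σ̲ > 0, σ̲ < σ̃. -/
theorem stmt_7 (ρ R σl : ℝ) (hρ : 0 < ρ) (hR : ρ < R) (hσ : 0 < σl) :
    σl < (3 * R ^ 2 / (R ^ 3 - ρ ^ 3)) * (2 * σl * ρ ^ 2 / Real.pi)
      * (k1 ρ * i1 R - i1 ρ * k1 R) := by
  have hR0 : 0 < R := hρ.trans hR
  have hd : 0 < R ^ 3 - ρ ^ 3 := sub_pos.2 (pow_lt_pow_left₀ hR hρ.le (by norm_num))
  have ht : 0 < R - ρ := sub_pos.2 hR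
  have h1 := aux_cosh _ ht
  have h2 := Real.self_lt_sinh_iff.2 ht
  have h3 := mul_lt_mul_of_pos_left h2 (mul_pos hρ hR0)
  rw [aux_id ρ R hρ hR0]
  have hpi := Real.pi_pos
  generalize Real.sinh (R - ρ) = S at *
  generalize Real.cosh (R - ρ) = C at *
  have e : (3 * R ^ 2 / (R ^ 3 - ρ ^ 3)) * (2 * σl * ρ ^ 2 / Real.pi)
      * ((Real.pi / 2) / (ρ ^ 2 * R ^ 2) * ((ρ * R - 1) * S + (R - ρ) * C))
      = σl * (3 * ((ρ * R - 1) * S + (R - ρ) * C)) / (R ^ 3 - ρ ^ 3) := by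
    have := hd.ne'
    field_simp
  rw [e, lt_div_iff₀ hd]
  apply mul_lt_mul_of_pos_left _ hσ
  linarith
end

section
/- Let β > 0, 0 < σ̲ < 1, 0 < ρ < R, and suppose (k1(ρ)i1(R) − i1(ρ)k1(R)) + β(k1(ρ)i0(R) + i1(ρ)k0(R)) = πβ/(2σ̲ρ²). Then σ_s(R) := (2/π)σ̲ρ²(k1(ρ)i0(R) + i1(ρ)k0(R)) satisfies σ_s(R) = 1 − (2σ̲ρ²/(πβ))(k1(ρ)i1(R) − i1(ρ)k1(R)) < 1. -/
theorem aux_sinh (d : ℝ) (hd : 0 < d) : Real.sinh d < d * Real.cosh d := by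
  obtain ⟨c, hc, h⟩ := exists_deriv_eq_slope Real.sinh hd
    Real.continuous_sinh.continuousOn Real.differentiable_sinh.differentiableOn
  rw [Real.deriv_sinh, Real.sinh_zero, sub_zero, sub_zero, eq_div_iff hd.ne'] at h
  have h2 : Real.cosh c < Real.cosh d := by
    rw [Real.cosh_lt_cosh, abs_of_pos hc.1, abs_of_pos hd]
    exact hc.2
  nlinarith

theorem aux_D (ρ R : ℝ) (hρ : 0 < ρ) (hR : ρ < R) : 0 < k1 ρ * i1 R - i1 ρ * k1 R := by
  have hR0 : 0 < R := hρ.trans hR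
  have hd : 0 < R - ρ := sub_pos.2 hR
  have key : k1 ρ * i1 R - i1 ρ * k1 R = Real.pi / (2 * ρ ^ 2 * R ^ 2) *
      ((ρ * R - 1) * Real.sinh (R - ρ) + (R - ρ) * Real.cosh (R - ρ)) := by
    unfold k1 i1
    rw [Real.sinh_sub, Real.cosh_sub, ← Real.cosh_sub_sinh, ← Real.cosh_sub_sinh]
    field_simp
    ring
  rw [key]
  have h1 := aux_sinh _ hd
  have h2 : 0 < Real.sinh (R - ρ) := Real.sinh_pos_iff.2 hd
  have h3 : 0 < ρ * R * Real.sinh (R - ρ) := by positivity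
  have h4 : 0 < (ρ * R - 1) * Real.sinh (R - ρ) + (R - ρ) * Real.cosh (R - ρ) := by linarith
  have := Real.pi_pos
  positivity

/-- Under the stationarity equation, σ_s(R) = 1 − (2σ̲ρ²/(πβ))(k₁(ρ)i₁(R)−i₁(ρ)k₁(R)) < 1. -/
theorem stmt_9 (β σl ρ R : ℝ) (hβ : 0 < β) (hσ0 : 0 < σl) (hσ1 : σl < 1)
    (hρ : 0 < ρ) (hR : ρ < R)
    (heq : (k1 ρ * i1 R - i1 ρ * k1 R) + β * (k1 ρ * i0 R + i1 ρ * k0 R)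
      = Real.pi * β / (2 * σl * ρ ^ 2)) :
    (2 / Real.pi) * σl * ρ ^ 2 * (k1 ρ * i0 R + i1 ρ * k0 R)
      = 1 - (2 * σl * ρ ^ 2 / (Real.pi * β)) * (k1 ρ * i1 R - i1 ρ * k1 R) ∧
    (2 / Real.pi) * σl * ρ ^ 2 * (k1 ρ * i0 R + i1 ρ * k0 R) < 1 := by
  have hD := aux_D ρ R hρ hR
  have hpi := Real.pi_pos
  generalize k1 ρ * i1 R - i1 ρ * k1 R = D at *
  generalize k1 ρ * i0 R + i1 ρ * k0 R = E at *
  have h1 : (2 / Real.pi) * σl * ρ ^ 2 * E = 1 - (2 * σl * ρ ^ 2 / (Real.pi * β)) * D := by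
    field_simp at heq ⊢
    linarith
  refine ⟨h1, ?_⟩
  rw [h1]
  have : 0 < (2 * σl * ρ ^ 2 / (Real.pi * β)) * D := by positivity
  linarith
end

section
/- Let σ̲ > 0 and ρ > 0, and define σ_s(r) = (2/π)σ̲ρ²(k1(ρ)i0(r) + i1(ρ)k0(r)) for r > 0. Then σ_s is twice differentiable on (0, ∞) and satisfies σ_s''(r) + (2/r)σ_s'(r) − σ_s(r) = 0 for all r > 0, together with σ_s(ρ) = σ̲ and σ_s'(ρ) = 0. -/
theorem hasDeriv_i0 {r : ℝ} (h : r ≠ 0) : HasDerivAt i0 (i1 r) r := by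
  have := (Real.hasDerivAt_sinh r).div (hasDerivAt_id r) h
  refine HasDerivAt.congr_deriv (f := i0) this ?_
  simp only [i1, id]
  field_simp

theorem hasDeriv_exp_neg (r : ℝ) : HasDerivAt (fun s : ℝ => Real.exp (-s)) (-Real.exp (-r)) r := by
  have := (hasDerivAt_neg r).exp
  simpa using this

theorem hasDeriv_k0 {r : ℝ} (h : r ≠ 0) : HasDerivAt k0 (-k1 r) r := by
  have := ((hasDeriv_exp_neg r).const_mul (Real.pi / 2)).div (hasDerivAt_id r) h
  refine HasDerivAt.congr_deriv (f := k0) this ?_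
  simp only [k1, id]
  field_simp
  ring

theorem hasDeriv_i1 {r : ℝ} (h : r ≠ 0) : HasDerivAt i1 (i0 r - 2 / r * i1 r) r := by
  have := ((Real.hasDerivAt_cosh r).div (hasDerivAt_id r) h).sub
    ((Real.hasDerivAt_sinh r).div (hasDerivAt_pow 2 r) (pow_ne_zero 2 h))
  refine HasDerivAt.congr_deriv (f := i1) this ?_
  simp only [i0, i1, id]
  field_simp
  norm_num
  ring

theorem hasDeriv_k1 {r : ℝ} (h : r ≠ 0) : HasDerivAt k1 (-k0 r - 2 / r * k1 r) r := by
  have := ((hasDeriv_exp_neg r).const_mul (Real.pi / 2)).mul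
    (((hasDerivAt_const r (1:ℝ)).div (hasDerivAt_id r) h).add
    ((hasDerivAt_const r (1:ℝ)).div (hasDerivAt_pow 2 r) (pow_ne_zero 2 h)))
  refine HasDerivAt.congr_deriv (f := k1) this ?_
  simp [k0, k1]
  field_simp
  ring

/-- σ_s is twice differentiable on (0,∞) and solves σ'' + (2/r)σ' − σ = 0
with σ_s(ρ) = σ̲ and σ_s'(ρ) = 0. -/
theorem stmt_10 (σl ρ : ℝ) (hσ : 0 < σl) (hρ : 0 < ρ) :
    let σs : ℝ → ℝ := fun r => (2 / Real.pi) * σl * ρ ^ 2 * (k1 ρ * i0 r + i1 ρ * k0 r)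
    (∀ r : ℝ, 0 < r → DifferentiableAt ℝ σs r ∧ DifferentiableAt ℝ (deriv σs) r) ∧
    (∀ r : ℝ, 0 < r → deriv (deriv σs) r + (2 / r) * deriv σs r - σs r = 0) ∧
    σs ρ = σl ∧ deriv σs ρ = 0 := by
  intro σs
  have h1 : ∀ r : ℝ, 0 < r → HasDerivAt σs
      ((2 / Real.pi) * σl * ρ ^ 2 * (k1 ρ * i1 r + i1 ρ * (-k1 r))) r := fun r hr =>
    (((hasDeriv_i0 hr.ne').const_mul (k1 ρ)).add
      ((hasDeriv_k0 hr.ne').const_mul (i1 ρ))).const_mul _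
  have h2 : ∀ r : ℝ, 0 < r → HasDerivAt (deriv σs)
      ((2 / Real.pi) * σl * ρ ^ 2 * (k1 ρ * (i0 r - 2 / r * i1 r)
        + i1 ρ * (-(-k0 r - 2 / r * k1 r)))) r := fun r hr => by
    have h3 : HasDerivAt
        (fun r => (2 / Real.pi) * σl * ρ ^ 2 * (k1 ρ * i1 r + i1 ρ * (-k1 r))) _ r :=
      (((hasDeriv_i1 hr.ne').const_mul (k1 ρ)).add
        ((hasDeriv_k1 hr.ne').neg.const_mul (i1 ρ))).const_mul _
    refine h3.congr_of_eventuallyEq ?_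
    filter_upwards [lt_mem_nhds hr] with x hx
    exact (h1 x hx).deriv
  refine ⟨fun r hr => ⟨(h1 r hr).differentiableAt, (h2 r hr).differentiableAt⟩,
    fun r hr => ?_, ?_, ?_⟩
  · rw [(h2 r hr).deriv, (h1 r hr).deriv]
    simp only [σs]
    ring
  · have hp := Real.pi_ne_zero
    have he : Real.exp (-ρ) * (Real.cosh ρ + Real.sinh ρ) = 1 := by
      rw [Real.cosh_add_sinh, ← Real.exp_add]; simp
    have key : σs ρ = σl * (Real.exp (-ρ) * (Real.cosh ρ + Real.sinh ρ)) := by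
      simp only [σs, i0, i1, k0, k1]
      field_simp
      ring
    rw [key, he, mul_one]
  · rw [(h1 ρ hρ).deriv]
    ring
end

section
/- Let 0 < ρ < R and β > 0. Define i2(s) = i0(s) − (3/s)i1(s) and k2(s) = k0(s) + (3/s)k1(s). Then M_{1,1} = 0 and M_{2,1} = 0, where M_{1,1} = (1/R)(i1(R)k1(ρ) − i1(ρ)k1(R))·[(i0(R)k1(ρ) + i1(ρ)k0(R)) − (3R²/(R³ − ρ³))(i1(R)k1(ρ) − i1(ρ)k1(R))] + ((i1(R)k1(ρ) − i1(ρ)k1(R))/(R(R³ − ρ³)))·[3R³(ρ³/R³)(i0(R)k1(ρ) + i1(ρ)k0(R)) − 6R²(ρ³/R³)(i1(R)k1(ρ) − i1(ρ)k1(R)) − (R³ + 2ρ³)(i1(ρ)k2(R) + i2(R)k1(ρ))], and M_{2,1} = (i1(R)k1(ρ) − i1(ρ)k1(R))·[(i0(R)k1(ρ) + i1(ρ)k0(R)) − (3R²/(R³ − ρ³))(i1(R)k1(ρ) − i1(ρ)k1(R))] − (i1(R)k1(ρ) − i1(ρ)k1(R))·[(i1(ρ)k2(R) + i2(R)k1(ρ))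 − (3R²/(R³ − ρ³))(ρ³/R³)(i1(R)k1(ρ) − i1(ρ)k1(R))]. Consequently W_1 := M_{1,1} + M_{2,1}β = 0, which yields B_1 = 0 in the linearization of the stationary tumor problem. -/
/-- Modified spherical Bessel function of order 2, via the recurrence. -/
noncomputable def i2 (s : ℝ) : ℝ := i0 s - (3 / s) * i1 s

/-- Modified spherical Bessel function of order 2, via the recurrence. -/
noncomputable def k2 (s : ℝ) : ℝ := k0 s + (3 / s) * k1 s

/-- M_{1,1} = 0 and M_{2,1} = 0, hence W₁ = M_{1,1} + M_{2,1}β = 0 (so B₁ = 0). -/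
theorem stmt_12 (ρ R β : ℝ) (hρ : 0 < ρ) (hR : ρ < R) (hβ : 0 < β) :
    let M11 : ℝ := (1 / R) * (i1 R * k1 ρ - i1 ρ * k1 R)
        * ((i0 R * k1 ρ + i1 ρ * k0 R)
          - (3 * R ^ 2 / (R ^ 3 - ρ ^ 3)) * (i1 R * k1 ρ - i1 ρ * k1 R))
      + ((i1 R * k1 ρ - i1 ρ * k1 R) / (R * (R ^ 3 - ρ ^ 3)))
        * (3 * R ^ 3 * (ρ ^ 3 / R ^ 3) * (i0 R * k1 ρ + i1 ρ * k0 R)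
          - 6 * R ^ 2 * (ρ ^ 3 / R ^ 3) * (i1 R * k1 ρ - i1 ρ * k1 R)
          - (R ^ 3 + 2 * ρ ^ 3) * (i1 ρ * k2 R + i2 R * k1 ρ))
    let M21 : ℝ := (i1 R * k1 ρ - i1 ρ * k1 R)
        * ((i0 R * k1 ρ + i1 ρ * k0 R)
          - (3 * R ^ 2 / (R ^ 3 - ρ ^ 3)) * (i1 R * k1 ρ - i1 ρ * k1 R))
      - (i1 R * k1 ρ - i1 ρ * k1 R)
        * ((i1 ρ * k2 R + i2 R * k1 ρ)
          - (3 * R ^ 2 / (R ^ 3 - ρ ^ 3)) * (ρ ^ 3 / R ^ 3) * (i1 R * k1 ρ - i1 ρ * k1 R))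
    M11 = 0 ∧ M21 = 0 ∧ M11 + M21 * β = 0 := by
  have hR0 : R ≠ 0 := (hρ.trans hR).ne'
  have hD : R ^ 3 - ρ ^ 3 ≠ 0 := by
    have : ρ ^ 3 < R ^ 3 := by gcongr
    exact (sub_pos.mpr this).ne'
  have hE : i1 ρ * k2 R + i2 R * k1 ρ
      = (i0 R * k1 ρ + i1 ρ * k0 R) - 3 / R * (i1 R * k1 ρ - i1 ρ * k1 R) := by
    unfold i2 k2
    ring
  rw [hE]
  generalize i0 R * k1 ρ + i1 ρ * k0 R = A
  generalize i1 R * k1 ρ - i1 ρ * k1 R = D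
  intro M11 M21
  have h1 : M11 = 0 := by
    simp only [M11]
    field_simp
    ring
  have h2 : M21 = 0 := by
    simp only [M21]
    field_simp
    ring
  exact ⟨h1, h2, by rw [h1, h2]; ring⟩
end

section
/- Let 0 < ρ < R, β > 0, and 0 < σ̲ < 1. Set σ_s(R) = (2/π)σ̲ρ²(k1(ρ)i0(R) + i1(ρ)k0(R)), σ̃ = (3R²/(R³ − ρ³))·(2σ̲ρ²/π)(k1(ρ)i1(R) − i1(ρ)k1(R)), λ = (2/π)σ̲ρ²[i0(R)k1(ρ) + i1(ρ)k0(R) + (β − 2/R)(i1(R)k1(ρ) − i1(ρ)k1(R))], D₀ = β(i0(R)k0(ρ) − i0(ρ)k0(R)) + i0(ρ)k1(R) + i1(R)k0(ρ), Q₀(r) = (i0(r)k0(ρ) − i0(ρ)k0(r))/D₀, and B₀ = σ_s(R) − σ̃ − λ[Q₀'(R) − (σ̃/σ̲)(ρ²/R²)Q₀'(ρ)]. Then B₀ < 0. -/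
open Real in
lemma aux_mono_s13 (f f' : ℝ → ℝ) (hd : ∀ x, HasDerivAt f (f' x) x) (h0 : f 0 = 0)
    (hp : ∀ x, 0 ≤ x → 0 ≤ f' x) : ∀ x, 0 ≤ x → 0 ≤ f x := by
  intro x hx
  have hm : MonotoneOn f (Set.Ici 0) := by
    apply monotoneOn_of_deriv_nonneg (convex_Ici 0)
    · exact fun y _ => (hd y).continuousAt.continuousWithinAt
    · exact fun y _ => (hd y).differentiableAt.differentiableWithinAt
    · intro y hy
      rw [(hd y).deriv]
      rw [interior_Ici] at hy
      exact hp y (le_of_lt hy)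
  have := hm (Set.mem_Ici.2 le_rfl) (Set.mem_Ici.2 hx) hx
  rwa [h0] at this

/-- p sinh + q cosh + w -/
lemma aux_pq (p q w p' q' w' : ℝ → ℝ) (hp : ∀ x, HasDerivAt p (p' x) x)
    (hq : ∀ x, HasDerivAt q (q' x) x) (hw : ∀ x, HasDerivAt w (w' x) x)
    (h0 : q 0 + w 0 = 0)
    (h : ∀ x, 0 ≤ x → 0 ≤ (p' x + q x) * Real.sinh x + (q' x + p x) * Real.cosh x + w' x) :
    ∀ x, 0 ≤ x → 0 ≤ p x * Real.sinh x + q x * Real.cosh x + w x := by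
  apply aux_mono_s13 (fun x => p x * Real.sinh x + q x * Real.cosh x + w x)
    (fun x => (p' x + q x) * Real.sinh x + (q' x + p x) * Real.cosh x + w' x)
  · intro x
    have := (((hp x).mul (Real.hasDerivAt_sinh x)).add ((hq x).mul (Real.hasDerivAt_cosh x))).add (hw x)
    refine this.congr_deriv ?_
    ring
  · simpa using h0
  · exact h

/-- derivative of polynomial a + b x + c x^2 + d x^3 + e x^4 -/
lemma aux_poly (a b c d e : ℝ) (x : ℝ) :
    HasDerivAt (fun x : ℝ => a + b * x + c * x ^ 2 + d * x ^ 3 + e * x ^ 4)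
      (b + 2 * c * x + 3 * d * x ^ 2 + 4 * e * x ^ 3) x := by
  have h := (((((hasDerivAt_id x).const_mul b).const_add a).add
    ((hasDerivAt_pow 2 x).const_mul c)).add ((hasDerivAt_pow 3 x).const_mul d)).add
    ((hasDerivAt_pow 4 x).const_mul e)
  refine (h.congr_deriv ?_)
  norm_num
  ring

lemma aux_step (p0 p1 p2 p3 p4 q0 q1 q2 q3 q4 w0 w1 w2 w3 w4 : ℝ) (h0 : q0 + w0 = 0)
    (h : ∀ x : ℝ, 0 ≤ x → 0 ≤
      ((p1 + 2 * p2 * x + 3 * p3 * x ^ 2 + 4 * p4 * x ^ 3)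
        + (q0 + q1 * x + q2 * x ^ 2 + q3 * x ^ 3 + q4 * x ^ 4)) * Real.sinh x
      + ((q1 + 2 * q2 * x + 3 * q3 * x ^ 2 + 4 * q4 * x ^ 3)
        + (p0 + p1 * x + p2 * x ^ 2 + p3 * x ^ 3 + p4 * x ^ 4)) * Real.cosh x
      + (w1 + 2 * w2 * x + 3 * w3 * x ^ 2 + 4 * w4 * x ^ 3)) :
    ∀ x : ℝ, 0 ≤ x → 0 ≤ (p0 + p1 * x + p2 * x ^ 2 + p3 * x ^ 3 + p4 * x ^ 4) * Real.sinh x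
      + (q0 + q1 * x + q2 * x ^ 2 + q3 * x ^ 3 + q4 * x ^ 4) * Real.cosh x
      + (w0 + w1 * x + w2 * x ^ 2 + w3 * x ^ 3 + w4 * x ^ 4) := by
  refine aux_pq _ _ _ _ _ _ (aux_poly p0 p1 p2 p3 p4) (aux_poly q0 q1 q2 q3 q4)
    (aux_poly w0 w1 w2 w3 w4) ?_ h
  simpa using h0

lemma aux_sh {x : ℝ} (hx : 0 ≤ x) : 0 ≤ Real.sinh x := Real.sinh_nonneg_iff.2 hx

/-- x cosh x - sinh x -/
lemma ya : ∀ x : ℝ, 0 ≤ x → 0 ≤ x * Real.cosh x - Real.sinh x := by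
  intro x hx
  have := aux_step (-1) 0 0 0 0 0 1 0 0 0 0 0 0 0 0 (by norm_num) (fun x hx => by
    have := mul_nonneg hx (aux_sh hx); linarith) x hx
  linarith

lemma ya_pos {x : ℝ} (hx : 0 < x) : 0 < x * Real.cosh x - Real.sinh x := by
  have hm : StrictMonoOn (fun x : ℝ => x * Real.cosh x - Real.sinh x) (Set.Ici 0) := by
    apply strictMonoOn_of_deriv_pos (convex_Ici 0)
    · fun_prop
    · intro y hy
      rw [interior_Ici] at hy
      have h : HasDerivAt (fun x : ℝ => x * Real.cosh x - Real.sinh x) (y * Real.sinh y) y := by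
        refine (((hasDerivAt_id y).mul (Real.hasDerivAt_cosh y)).sub (Real.hasDerivAt_sinh y)).congr_deriv ?_
        simp
      rw [h.deriv]
      exact mul_pos hy (Real.sinh_pos_iff.2 hy)
  have := hm (Set.mem_Ici.2 le_rfl) (Set.mem_Ici.2 hx.le) hx
  simpa using this

lemma yb : ∀ x : ℝ, 0 ≤ x → 0 ≤ x * Real.sinh x - 2 * Real.cosh x + 2 := by
  intro x hx
  have := aux_step 0 1 0 0 0 (-2) 0 0 0 0 2 0 0 0 0 (by norm_num) (fun x hx => by
    have := ya x hx; linarith) x hx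
  linarith

lemma yc : ∀ x : ℝ, 0 ≤ x → 0 ≤ x * Real.cosh x - 3 * Real.sinh x + 2 * x := by
  intro x hx
  have := aux_step (-3) 0 0 0 0 0 1 0 0 0 0 2 0 0 0 (by norm_num) (fun x hx => by
    have := yb x hx; linarith) x hx
  linarith

lemma yd : ∀ x : ℝ, 0 ≤ x → 0 ≤ x * Real.sinh x + x ^ 2 - 4 * Real.cosh x + 4 := by
  intro x hx
  have := aux_step 0 1 0 0 0 (-4) 0 0 0 0 4 0 1 0 0 (by norm_num) (fun x hx => by
    have := yc x hx; linarith) x hx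
  linarith

lemma ye : ∀ x : ℝ, 0 ≤ x → 0 ≤ (4 * x ^ 2 - 6) * Real.sinh x + 6 * x * Real.cosh x := by
  intro x hx
  have := aux_step (-6) 0 4 0 0 0 6 0 0 0 0 0 0 0 0 (by norm_num) (fun x hx => by
    have h1 := mul_nonneg hx (aux_sh hx)
    have h2 := mul_nonneg (sq_nonneg x) (Real.cosh_pos x).le
    linarith) x hx
  linarith

lemma yf : ∀ x : ℝ, 0 ≤ x →
    0 ≤ (4 * x ^ 3 + 6 * x) * Real.cosh x - (6 * x ^ 2 + 6) * Real.sinh x := by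
  intro x hx
  have := aux_step (-6) 0 (-6) 0 0 0 6 0 4 0 0 0 0 0 0 (by norm_num) (fun x hx => by
    have h1 := mul_nonneg hx (ye x hx)
    linarith) x hx
  linarith

lemma m3 : ∀ x : ℝ, 0 ≤ x → 0 ≤ (17 * x ^ 2 - 42) * Real.sinh x + (x ^ 3 + 42 * x) * Real.cosh x := by
  intro x hx
  have := aux_step (-42) 0 17 0 0 0 42 0 1 0 0 0 0 0 0 (by norm_num) (fun x hx => by
    have h1 := mul_nonneg hx (aux_sh hx)
    have h3 := mul_nonneg (pow_nonneg hx 3) (aux_sh hx)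
    have h2 := mul_nonneg (sq_nonneg x) (Real.cosh_pos x).le
    linarith) x hx
  linarith

lemma m2 : ∀ x : ℝ, 0 ≤ x →
    0 ≤ (x ^ 3 + 14 * x) * Real.sinh x + (14 * x ^ 2 - 56) * Real.cosh x + 56 := by
  intro x hx
  have := aux_step 0 14 0 1 0 (-56) 0 14 0 0 56 0 0 0 0 (by norm_num) (fun x hx => by
    have h1 := m3 x hx
    linarith) x hx
  linarith

lemma m1 : ∀ x : ℝ, 0 ≤ x →
    0 ≤ (11 * x ^ 2 - 48) * Real.sinh x + (x ^ 3 - 8 * x) * Real.cosh x + 56 * x := by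
  intro x hx
  have := aux_step (-48) 0 11 0 0 0 (-8) 0 1 0 0 56 0 0 0 (by norm_num) (fun x hx => by
    have h1 := m2 x hx
    linarith) x hx
  linarith

lemma m0 : ∀ x : ℝ, 0 ≤ x →
    0 ≤ (x ^ 3 - 24 * x) * Real.sinh x + (8 * x ^ 2 - 24) * Real.cosh x + 28 * x ^ 2 + 24 := by
  intro x hx
  have := aux_step 0 (-24) 0 1 0 (-24) 0 8 0 0 24 0 28 0 0 (by norm_num) (fun x hx => by
    have h1 := m1 x hx
    linarith) x hx
  linarith

lemma mm : ∀ x : ℝ, 0 ≤ x →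
    0 ≤ (4 * x ^ 3 + 48 * x) * Real.sinh x + (x ^ 4 - 36 * x ^ 2 - 48) * Real.cosh x
      + 7 * x ^ 4 + 12 * x ^ 2 + 48 := by
  intro x hx
  have := aux_step 0 48 0 4 0 (-48) 0 (-36) 0 1 48 0 12 0 7 (by norm_num) (fun x hx => by
    have h1 := mul_nonneg hx (m0 x hx)
    linarith) x hx
  linarith

lemma keyH (r d : ℝ) (hr : 0 < r) (hd : 0 < d) (S C : ℝ) (hS : S = Real.sinh d)
    (hC : C = Real.cosh d) :
    ((r+d)^3-r^3)*((r+d)^2*(r*C+S)*S-(((r+d)*r-1)*S+d*C)*((r+d)*C-S))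
      -3*(r+d)^3*S*(((r+d)*r-1)*S+d*C)+3*r*(((r+d)*r-1)*S+d*C)^2 ≤ 0 := by
  have hx : (0:ℝ) ≤ 2 * d := by linarith
  have h2 := yc _ hx
  have h0 := yd _ hx
  have h1 := mm _ hx
  have e : C ^ 2 = 1 + S ^ 2 := by rw [hS, hC, Real.cosh_sq]; ring
  rw [Real.sinh_two_mul, Real.cosh_two_mul, ← hS, ← hC, e] at h0 h1 h2
  have a0 := mul_nonneg (pow_nonneg hd.le 3) h0
  have a1 := mul_nonneg hr.le h1
  have a2 := mul_nonneg (mul_nonneg (sq_nonneg r) (sq_nonneg d)) h2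
  have a3 := mul_nonneg (pow_nonneg hr.le 3) (sq_nonneg (d * C - S))
  have : ((r+d)^3-r^3)*((r+d)^2*(r*C+S)*S-(((r+d)*r-1)*S+d*C)*((r+d)*C-S))
      -3*(r+d)^3*S*(((r+d)*r-1)*S+d*C)+3*r*(((r+d)*r-1)*S+d*C)^2 =
      - (3 * (r ^ 3 * (d * C - S) ^ 2)) 
      - (r ^ 2 * d ^ 2 * (2 * d * (1 + S ^ 2 + S ^ 2) - 3 * (2 * S * C) + 2 * (2 * d)))
      - (1/32) * (r * ((4 * (2 * d) ^ 3 + 48 * (2 * d)) * (2 * S * C) + ((2 * d) ^ 4 - 36 * (2 * d) ^ 2 - 48) * (1 + S ^ 2 + S ^ 2) + 7 * (2 * d) ^ 4 + 12 * (2 * d) ^ 2 + 48))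
      - (1/4) * (d ^ 3 * (2 * d * (2 * S * C) + (2 * d) ^ 2 - 4 * (1 + S ^ 2 + S ^ 2) + 4)) := by
    linear_combination (-((r+d)^3-r^3) * d * (r+d) + 3 * r * d^2 + 3 * r^3 * d^2) * e
  rw [this]
  linarith

lemma keyP (r d : ℝ) (hr : 0 < r) (hd : 0 < d) (S C : ℝ) (hS : S = Real.sinh d)
    (hC : C = Real.cosh d) :
    0 < ((r+d)^3+2*r^3)*((r+d)*C-S)
      - 3*r*((r+d)^2*(r*C+S) - 2*(((r+d)*r-1)*S+d*C)) := by
  have h := ya_pos hd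
  have h1 := yf d hd.le
  rw [← hS, ← hC] at h h1
  have a0 := mul_pos (pow_pos hd 3) h
  have a1 := mul_nonneg hr.le h1
  have a2 := mul_pos (mul_pos (pow_pos hr 2) hd) h
  linarith

lemma exp_eq (s : ℝ) : Real.exp (-s) = Real.cosh s - Real.sinh s := by
  rw [Real.cosh_sub_sinh]

lemma fF (ρ R : ℝ) (hρ : 0 < ρ) (hR : 0 < R) : k1 ρ * i0 R + i1 ρ * k0 R
    = (Real.pi / 2) * (ρ * Real.cosh (R - ρ) + Real.sinh (R - ρ)) / (R * ρ ^ 2) := by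
  unfold k1 i0 i1 k0
  rw [exp_eq, exp_eq, Real.cosh_sub, Real.sinh_sub]
  field_simp
  ring

lemma fE (ρ R : ℝ) (hρ : 0 < ρ) (hR : 0 < R) : k1 ρ * i1 R - i1 ρ * k1 R
    = (Real.pi / 2) * ((R * ρ - 1) * Real.sinh (R - ρ) + (R - ρ) * Real.cosh (R - ρ))
      / (R ^ 2 * ρ ^ 2) := by
  unfold k1 i1
  rw [exp_eq, exp_eq, Real.cosh_sub, Real.sinh_sub]
  field_simp
  ring

lemma fG (ρ r : ℝ) (hρ : 0 < ρ) : i0 r * k0 ρ - i0 ρ * k0 r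
    = (Real.pi / 2) / ρ * (Real.sinh (r - ρ) / r) := by
  unfold i0 k0
  rw [exp_eq, exp_eq, Real.sinh_sub]
  rcases eq_or_ne r 0 with rfl | hr
  · simp
  field_simp
  ring

lemma fG' (ρ R : ℝ) (hρ : 0 < ρ) (hR : 0 < R) : i0 ρ * k1 R + i1 R * k0 ρ
    = (Real.pi / 2) / ρ * ((R * Real.cosh (R - ρ) - Real.sinh (R - ρ)) / R ^ 2) := by
  unfold i0 k0 i1 k1
  rw [exp_eq, exp_eq, Real.sinh_sub, Real.cosh_sub]
  field_simp
  ring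

lemma dG (ρ c D r : ℝ) (hr : 0 < r) :
    deriv (fun r => c * (Real.sinh (r - ρ) / r) / D) r
      = c * ((r * Real.cosh (r - ρ) - Real.sinh (r - ρ)) / r ^ 2) / D := by
  have h : HasDerivAt (fun r => Real.sinh (r - ρ)) (Real.cosh (r - ρ)) r := by
    simpa using ((hasDerivAt_id r).sub_const ρ).sinh
  have := ((h.div (hasDerivAt_id r) hr.ne').const_mul c).div_const D
  refine (this.congr_deriv ?_).deriv
  simp [mul_comm]

lemma final (ρ d β S C R : ℝ) (hρ : 0 < ρ) (hd : 0 < d) (hβ : 0 < β) (hR : R = ρ + d)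
    (hS : S = Real.sinh d) (hC : C = Real.cosh d) (F E G G' T : ℝ)
    (hF : F = (ρ * C + S) / R) (hE : E = ((R * ρ - 1) * S + d * C) / R ^ 2)
    (hG : G = S / R) (hG' : G' = (R * C - S) / R ^ 2) (hT : T = 3 * R ^ 2 / (R ^ 3 - ρ ^ 3) * E) :
    F - T - (F + (β - 2 / R) * E) * (G' / (β * G + G') - T * (ρ ^ 2 / R ^ 2) * ((1 / ρ) / (β * G + G'))) < 0 := by
  have hR0 : 0 < R := by linarith
  have hS0 : 0 < S := by rw [hS]; exact Real.sinh_pos_iff.2 hd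
  have hC0 : 0 < C := by rw [hC]; exact Real.cosh_pos d
  have hy : 0 < d * C - S := by rw [hS, hC]; exact ya_pos hd
  have hK : 0 < R ^ 3 - ρ ^ 3 := by
    have : R ^ 3 - ρ ^ 3 = d * (3 * ρ ^ 2 + 3 * ρ * d + d ^ 2) := by rw [hR]; ring
    rw [this]; positivity
  have hG0 : 0 < G := by rw [hG]; positivity
  have hG'0 : 0 < G' := by
    rw [hG']
    have : 0 < R * C - S := by rw [hR]; nlinarith [mul_pos hρ hC0]
    positivity
  have hE0 : 0 < E := by
    rw [hE]
    have : 0 < (R * ρ - 1) * S + d * C := by nlinarith [mul_pos (mul_pos hR0 hρ) hS0]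
    positivity
  have hW : 0 < β * G + G' := by positivity
  have H := keyH ρ d hρ hd S C hS hC
  have P := keyP ρ d hρ hd S C hS hC
  rw [← hR] at H P
  have e1 : F - T - (F + (β - 2 / R) * E) * (G' / (β * G + G') - T * (ρ ^ 2 / R ^ 2) * ((1 / ρ) / (β * G + G')))
    = (β * ((F - T) * G - E * (G' - T * ρ / R ^ 2)) + (-T * G' + 2 / R * E * G' + F * T * ρ / R ^ 2 - 2 / R * E * T * ρ / R ^ 2)) / (β * G + G') := by
    field_simp
    ring
  rw [e1]
  apply div_neg_of_neg_of_pos _ hW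
  have c1 : (F - T) * G - E * (G' - T * ρ / R ^ 2) = ((R^3-ρ^3)*(R^2*(ρ*C+S)*S-((R*ρ-1)*S+d*C)*(R*C-S))
      -3*R^3*S*((R*ρ-1)*S+d*C)+3*ρ*((R*ρ-1)*S+d*C)^2) / (R ^ 4 * (R ^ 3 - ρ ^ 3)) := by
    rw [hT, hF, hE, hG, hG']
    field_simp
    ring
  have c2 : (-T * G' + 2 / R * E * G' + F * T * ρ / R ^ 2 - 2 / R * E * T * ρ / R ^ 2)
      = - (E * ((R^3+2*ρ^3)*(R*C-S) - 3*ρ*(R^2*(ρ*C+S) - 2*((R*ρ-1)*S+d*C))) / (R ^ 3 * (R ^ 3 - ρ ^ 3))) := by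
    have : -T * G' + 2 / R * E * G' + F * T * ρ / R ^ 2 - 2 / R * E * T * ρ / R ^ 2 =
      E * (-(3 * R ^ 2 / (R ^ 3 - ρ ^ 3)) * G' + 2 / R * G' + F * (3 * R ^ 2 / (R ^ 3 - ρ ^ 3)) * ρ / R ^ 2 - 2 / R * E * (3 * R ^ 2 / (R ^ 3 - ρ ^ 3)) * ρ / R ^ 2) := by
      rw [hT]; ring
    rw [this, mul_div_assoc, ← mul_neg]
    congr 1
    rw [hF, hE, hG']
    field_simp
    ring
  rw [c1, c2]
  have n1 : ((R^3-ρ^3)*(R^2*(ρ*C+S)*S-((R*ρ-1)*S+d*C)*(R*C-S))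
      -3*R^3*S*((R*ρ-1)*S+d*C)+3*ρ*((R*ρ-1)*S+d*C)^2) / (R ^ 4 * (R ^ 3 - ρ ^ 3)) ≤ 0 :=
    div_nonpos_of_nonpos_of_nonneg H (by positivity)
  have n2 := div_pos (mul_pos hE0 P) (mul_pos (pow_pos hR0 3) hK)
  have n3 := mul_nonpos_of_nonneg_of_nonpos hβ.le n1
  linarith

/-- The mode-0 coefficient B₀ in the linearization is negative. -/
theorem stmt_13 (ρ R β σl : ℝ) (hρ : 0 < ρ) (hR : ρ < R) (hβ : 0 < β)
    (hσ0 : 0 < σl) (hσ1 : σl < 1) :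
    let σsR : ℝ := (2 / Real.pi) * σl * ρ ^ 2 * (k1 ρ * i0 R + i1 ρ * k0 R)
    let σt : ℝ := (3 * R ^ 2 / (R ^ 3 - ρ ^ 3)) * (2 * σl * ρ ^ 2 / Real.pi)
      * (k1 ρ * i1 R - i1 ρ * k1 R)
    let lam : ℝ := (2 / Real.pi) * σl * ρ ^ 2 * (i0 R * k1 ρ + i1 ρ * k0 R
      + (β - 2 / R) * (i1 R * k1 ρ - i1 ρ * k1 R))
    let D0 : ℝ := β * (i0 R * k0 ρ - i0 ρ * k0 R) + i0 ρ * k1 R + i1 R * k0 ρ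
    let Q0 : ℝ → ℝ := fun r => (i0 r * k0 ρ - i0 ρ * k0 r) / D0
    let B0 : ℝ := σsR - σt
      - lam * (deriv Q0 R - (σt / σl) * (ρ ^ 2 / R ^ 2) * deriv Q0 ρ)
    B0 < 0 := by
  intro σsR σt lam D0 Q0 B0
  have hR0 : 0 < R := hρ.trans hR
  have hd : 0 < R - ρ := sub_pos.2 hR
  have hpi := Real.pi_pos
  set S := Real.sinh (R - ρ) with hS
  set C := Real.cosh (R - ρ) with hC
  set F := (ρ * C + S) / R with hF
  set E := ((R * ρ - 1) * S + (R - ρ) * C) / R ^ 2 with hE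
  set G := S / R with hG
  set G' := (R * C - S) / R ^ 2 with hG'
  set T := 3 * R ^ 2 / (R ^ 3 - ρ ^ 3) * E with hT
  have key := final ρ (R - ρ) β S C R hρ hd hβ (by ring) hS hC F E G G' T hF hE hG hG' hT
  have hc : (Real.pi / 2) / ρ ≠ 0 := by positivity
  have h1 : σsR = σl * F := by
    simp only [σsR]
    rw [fF ρ R hρ hR0, hF, hS, hC]
    field_simp
  have hEE : k1 ρ * i1 R - i1 ρ * k1 R = (Real.pi / 2) / ρ ^ 2 * E := by
    rw [fE ρ R hρ hR0, hE, hS, hC]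
    field_simp
  have h2 : σt = σl * T := by
    simp only [σt]
    rw [hEE, hT]
    field_simp
  have h3 : lam = σl * (F + (β - 2 / R) * E) := by
    have : lam = σsR + (2 / Real.pi) * σl * ρ ^ 2 * ((β - 2 / R) * (k1 ρ * i1 R - i1 ρ * k1 R)) := by
      simp only [lam, σsR]; ring
    rw [this, h1, hEE]
    field_simp
  have h4 : D0 = (Real.pi / 2) / ρ * (β * G + G') := by
    have : D0 = β * (i0 R * k0 ρ - i0 ρ * k0 R) + (i0 ρ * k1 R + i1 R * k0 ρ) := by
      simp only [D0]; ring
    rw [this, fG ρ R hρ, fG' ρ R hρ hR0, hG, hG']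
    ring
  have h5 : Q0 = fun r => (Real.pi / 2) / ρ * (Real.sinh (r - ρ) / r) / D0 := by
    funext r
    simp only [Q0]
    rw [fG ρ r hρ]
  have h6 : deriv Q0 R = G' / (β * G + G') := by
    rw [h5, dG _ _ _ _ hR0, h4, mul_div_mul_left _ _ hc]
  have h7 : deriv Q0 ρ = (1 / ρ) / (β * G + G') := by
    rw [h5, dG _ _ _ _ hρ, h4, mul_div_mul_left _ _ hc]
    simp [pow_two]
  have h8 : B0 = σl * (F - T - (F + (β - 2 / R) * E) * (G' / (β * G + G') - T * (ρ ^ 2 / R ^ 2) * ((1 / ρ) / (β * G + G')))) := by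
    simp only [B0]
    rw [h6, h7, h1, h2, h3, mul_div_cancel_left₀ _ hσ0.ne']
    ring
  rw [h8]
  exact mul_neg_of_pos_of_neg hσ0 key
end

section
/- Let R > 0 and define ξ(s) = 3Rs²(i0(R)k1(s) + i1(s)k0(R)) − 6s²(i1(R)k1(s) − i1(s)k1(R)) − (R³ + 2s³)(i0(s)k1(R) + i1(R)k0(s)) for 0 < s ≤ R. Then ξ(R) = 0 and ξ(s) < 0 for every 0 < s < R. -/
lemma aux1 (d : ℝ) (hd : 0 < d) : Real.sinh d - d * Real.cosh d < 0 := by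
  have hder : ∀ x : ℝ, HasDerivAt (fun x => Real.sinh x - x * Real.cosh x) (-(x * Real.sinh x)) x := by
    intro x
    have h := (Real.hasDerivAt_sinh x).sub ((hasDerivAt_id x).mul (Real.hasDerivAt_cosh x))
    refine h.congr_deriv ?_
    simp only [id]; ring
  have hm : StrictAntiOn (fun x => Real.sinh x - x * Real.cosh x) (Set.Ici 0) := by
    apply strictAntiOn_of_deriv_neg (convex_Ici 0)
    · exact fun x _ => (hder x).continuousAt.continuousWithinAt
    · intro x hx
      rw [interior_Ici] at hx
      have hx : 0 < x := hx
      rw [(hder x).deriv]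
      have := mul_pos hx (Real.sinh_pos_iff.2 hx)
      linarith
  have := hm (Set.mem_Ici.2 le_rfl) (Set.mem_Ici.2 hd.le) hd
  simpa using this

lemma aux2 (d : ℝ) (hd : 0 < d) :
    6 * (1 + d ^ 2) * Real.sinh d - (4 * d ^ 3 + 6 * d) * Real.cosh d < 0 := by
  have hder : ∀ x : ℝ, HasDerivAt
      (fun x => 6 * (1 + x ^ 2) * Real.sinh x - (4 * x ^ 3 + 6 * x) * Real.cosh x)
      (6 * x * (Real.sinh x - x * Real.cosh x) - 4 * x ^ 3 * Real.sinh x) x := by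
    intro x
    have h1 : HasDerivAt (fun x : ℝ => 6 * (1 + x ^ 2)) (12 * x) x := by
      refine (((hasDerivAt_pow 2 x).const_add 1).const_mul 6).congr_deriv ?_
      norm_num; ring
    have h2 : HasDerivAt (fun x : ℝ => 4 * x ^ 3 + 6 * x) (12 * x ^ 2 + 6) x := by
      refine (((hasDerivAt_pow 3 x).const_mul 4).add ((hasDerivAt_id x).const_mul 6)).congr_deriv ?_
      norm_num; ring
    have h := (h1.mul (Real.hasDerivAt_sinh x)).sub (h2.mul (Real.hasDerivAt_cosh x))
    refine h.congr_deriv ?_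
    ring
  have hm : StrictAntiOn
      (fun x => 6 * (1 + x ^ 2) * Real.sinh x - (4 * x ^ 3 + 6 * x) * Real.cosh x) (Set.Ici 0) := by
    apply strictAntiOn_of_deriv_neg (convex_Ici 0)
    · exact fun x _ => (hder x).continuousAt.continuousWithinAt
    · intro x hx
      rw [interior_Ici] at hx
      have hx : 0 < x := hx
      rw [(hder x).deriv]
      have h1 := mul_pos (pow_pos hx 3) (Real.sinh_pos_iff.2 hx)
      have h2 := mul_neg_of_pos_of_neg hx (aux1 x hx)
      linarith
  have := hm (Set.mem_Ici.2 le_rfl) (Set.mem_Ici.2 hd.le) hd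
  simpa using this

lemma aux3 (R s : ℝ) (hR : 0 < R) (hs : 0 < s) :
    3 * R * s ^ 2 * (i0 R * k1 s + i1 s * k0 R)
      - 6 * s ^ 2 * (i1 R * k1 s - i1 s * k1 R)
      - (R ^ 3 + 2 * s ^ 3) * (i0 s * k1 R + i1 R * k0 s) =
    Real.pi / 2 / (R ^ 2 * s) *
      ((R - s) ^ 3 * (Real.sinh (R - s) - (R - s) * Real.cosh (R - s))
      + s * (6 * (1 + (R - s) ^ 2) * Real.sinh (R - s)
        - (4 * (R - s) ^ 3 + 6 * (R - s)) * Real.cosh (R - s))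
      + 3 * s ^ 2 * (R - s) * (Real.sinh (R - s) - (R - s) * Real.cosh (R - s))) := by
  have hRs := hR.ne'
  have hss := hs.ne'
  have ha := Real.exp_ne_zero R
  have hb := Real.exp_ne_zero s
  unfold i0 i1 k0 k1
  simp only [Real.sinh_eq, Real.cosh_eq, neg_sub, Real.exp_sub, Real.exp_neg]
  generalize Real.exp R = a at *
  generalize Real.exp s = b at *
  field_simp
  ring

/-- The auxiliary function ξ vanishes at R and is negative on (0,R). -/
theorem stmt_15 (R : ℝ) (hR : 0 < R) :
    let ξ : ℝ → ℝ := fun s => 3 * R * s ^ 2 * (i0 R * k1 s + i1 s * k0 R)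
      - 6 * s ^ 2 * (i1 R * k1 s - i1 s * k1 R)
      - (R ^ 3 + 2 * s ^ 3) * (i0 s * k1 R + i1 R * k0 s)
    ξ R = 0 ∧ ∀ s : ℝ, 0 < s → s < R → ξ s < 0 := by
  intro ξ
  have key : ∀ s, 0 < s → ξ s = _ := fun s hs => aux3 R s hR hs
  refine ⟨?_, ?_⟩
  · rw [key R hR]; simp
  · intro s hs hsR
    rw [key s hs]
    have hd : 0 < R - s := sub_pos.2 hsR
    have h1 := aux1 _ hd
    have h2 := aux2 _ hd
    apply mul_neg_of_pos_of_neg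
    · have := Real.pi_pos
      positivity
    · have e1 := mul_neg_of_pos_of_neg (pow_pos hd 3) h1
      have e2 := mul_neg_of_pos_of_neg hs h2
      have e3 := mul_neg_of_pos_of_neg (by positivity : 0 < 3 * s ^ 2 * (R - s)) h1
      linarith
end

section
/- Let s > 0 and define u(R) = [2R⁴ − 4R³ + (−6s² + 12s + 6)R² + (4s³ − 6s² − 12s − 6)R − 2s³ + 3s² + 6s + 3]·e^{4(R − s)} − 2R⁴ − 4R³ + (6s² + 12s − 6)R² − (4s³ + 6s² − 12s + 6)R − 2s³ − 3s² + 6s − 3 for R ≥ s. Then u(s) = u'(s) = u''(s) = 0, u'''(s) = 240s² > 0, and u(R) > 0 for every R > s. -/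
noncomputable def gfun (s a b c d e a' b' c' d' e' : ℝ) : ℝ → ℝ := fun R =>
  (a * R ^ 4 + b * R ^ 3 + c * R ^ 2 + d * R + e) * Real.exp (4 * (R - s))
    + (a' * R ^ 4 + b' * R ^ 3 + c' * R ^ 2 + d' * R + e')

lemma gfun_hasDerivAt (s a b c d e a' b' c' d' e' R : ℝ) :
    HasDerivAt (gfun s a b c d e a' b' c' d' e')
      (gfun s (4 * a) (4 * b + 4 * a) (4 * c + 3 * b) (4 * d + 2 * c) (4 * e + d)
        0 (4 * a') (3 * b') (2 * c') d' R) R := by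
  have hp : ∀ a b c d e : ℝ, HasDerivAt
      (fun R : ℝ => a * R ^ 4 + b * R ^ 3 + c * R ^ 2 + d * R + e)
      (a * (4 * R ^ 3) + b * (3 * R ^ 2) + c * (2 * R) + d) R := by
    intro a b c d e
    have h4 := (hasDerivAt_pow 4 R).const_mul a
    have h3 := (hasDerivAt_pow 3 R).const_mul b
    have h2 := (hasDerivAt_pow 2 R).const_mul c
    have h1 := (hasDerivAt_id R).const_mul d
    have h := (((h4.add h3).add h2).add h1).add_const e
    refine h.congr_deriv ?_
    norm_num
  have he : HasDerivAt (fun R : ℝ => Real.exp (4 * (R - s)))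
      (Real.exp (4 * (R - s)) * (4 * 1)) R :=
    (((hasDerivAt_id R).sub_const s).const_mul 4).exp
  have h := ((hp a b c d e).mul he).add (hp a' b' c' d' e')
  refine h.congr_deriv ?_
  simp only [gfun]
  ring

lemma gfun_deriv (s a b c d e a' b' c' d' e' : ℝ) :
    deriv (gfun s a b c d e a' b' c' d' e') =
      gfun s (4 * a) (4 * b + 4 * a) (4 * c + 3 * b) (4 * d + 2 * c) (4 * e + d)
        0 (4 * a') (3 * b') (2 * c') d' :=
  funext fun R => (gfun_hasDerivAt s a b c d e a' b' c' d' e' R).deriv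

lemma pos_of_hasDeriv {f f' : ℝ → ℝ} (h : ∀ x, HasDerivAt f (f' x) x) (h0 : f 0 = 0)
    (hp : ∀ x, 0 < x → 0 < f' x) : ∀ x, 0 < x → 0 < f x := by
  intro x hx
  obtain ⟨c, hc, hc'⟩ := exists_hasDerivAt_eq_slope f f' hx
    (fun y _ => (h y).continuousAt.continuousWithinAt) (fun y _ => h y)
  have := hp c hc.1
  rw [hc', h0, sub_zero, sub_zero] at this
  exact (div_pos_iff_of_pos_right hx).1 this

lemma coefA (t : ℝ) (ht : 0 < t) :
    0 < (6 * t ^ 2 + 6 * t - 3) * Real.exp (4 * t) - (6 * t ^ 2 - 6 * t - 3) := by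
  have h1 := gfun_hasDerivAt 0 0 0 6 6 (-3) 0 0 (-6) 6 3
  have h2 := gfun_hasDerivAt 0 (4 * 0) (4 * 0 + 4 * 0) (4 * 6 + 3 * 0) (4 * 6 + 2 * 6)
    (4 * (-3) + 6) 0 (4 * 0) (3 * 0) (2 * (-6)) 6
  have := pos_of_hasDeriv h1 (by norm_num [gfun]) (pos_of_hasDeriv h2 (by norm_num [gfun]) (by
    intro x hx
    have he := Real.one_le_exp (show 0 ≤ 4 * x by linarith)
    norm_num [gfun]
    have : 0 < (96 * x ^ 2 + 192 * x) * Real.exp (4 * x) := by positivity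
    nlinarith)) t ht
  simp only [gfun, sub_zero] at this
  linarith

lemma coefC (t : ℝ) (ht : 0 < t) :
    0 < (2 * t ^ 4 - 4 * t ^ 3 + 6 * t ^ 2 - 6 * t + 3) * Real.exp (4 * t)
      - (2 * t ^ 4 + 4 * t ^ 3 + 6 * t ^ 2 + 6 * t + 3) := by
  have he := Real.sum_le_exp_of_nonneg (show 0 ≤ 4 * t by linarith) 7
  simp only [Finset.sum_range_succ, Finset.sum_range_zero, Nat.factorial] at he
  norm_num at he
  have hp : 0 < 2 * t ^ 4 - 4 * t ^ 3 + 6 * t ^ 2 - 6 * t + 3 := by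
    nlinarith [sq_nonneg (t * (t - 1)), sq_nonneg (t - 3 / 4)]
  have hm := mul_le_mul_of_nonneg_left he hp.le
  have hq : 0 < t ^ 5 * (8 / 5 + 16 / 5 * t - 64 / 15 * t ^ 2 + 64 / 3 * t ^ 3
      - 256 / 45 * t ^ 4 + 512 / 45 * t ^ 5) := by
    apply mul_pos (by positivity)
    have : 0 < t * (16 / 5 - 64 / 15 * t + 64 / 3 * t ^ 2 - 256 / 45 * t ^ 3
      + 512 / 45 * t ^ 4) := by
      apply mul_pos ht
      nlinarith [sq_nonneg (t - 1 / 4), sq_nonneg (t * (t - 1 / 4)), sq_nonneg (t ^ 2)]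
    nlinarith
  nlinarith


/-- Properties of the auxiliary function u: u, u', u'' vanish at s, u'''(s) = 240 s² > 0,
and u(R) > 0 for every R > s. -/
theorem stmt_19 (s : ℝ) (hs : 0 < s) :
    let u : ℝ → ℝ := fun R =>
      (2 * R ^ 4 - 4 * R ^ 3 + (-6 * s ^ 2 + 12 * s + 6) * R ^ 2
          + (4 * s ^ 3 - 6 * s ^ 2 - 12 * s - 6) * R - 2 * s ^ 3 + 3 * s ^ 2 + 6 * s + 3)
        * Real.exp (4 * (R - s))
      - 2 * R ^ 4 - 4 * R ^ 3 + (6 * s ^ 2 + 12 * s - 6) * R ^ 2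
      - (4 * s ^ 3 + 6 * s ^ 2 - 12 * s + 6) * R - 2 * s ^ 3 - 3 * s ^ 2 + 6 * s - 3
    u s = 0 ∧ deriv u s = 0 ∧ deriv (deriv u) s = 0 ∧
    deriv (deriv (deriv u)) s = 240 * s ^ 2 ∧ (0 : ℝ) < 240 * s ^ 2 ∧
    ∀ R : ℝ, s < R → 0 < u R := by
  intro u
  have hu : u = gfun s 2 (-4) (-6 * s ^ 2 + 12 * s + 6) (4 * s ^ 3 - 6 * s ^ 2 - 12 * s - 6)
      (-2 * s ^ 3 + 3 * s ^ 2 + 6 * s + 3) (-2) (-4) (6 * s ^ 2 + 12 * s - 6)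
      (-(4 * s ^ 3 + 6 * s ^ 2 - 12 * s + 6)) (-2 * s ^ 3 - 3 * s ^ 2 + 6 * s - 3) := by
    funext R
    simp only [u, gfun]
    ring
  refine ⟨?_, ?_, ?_, ?_, by positivity, ?_⟩
  · simp only [hu, gfun, sub_self, mul_zero, Real.exp_zero]
    ring
  · simp only [hu, gfun_deriv]
    simp only [gfun, sub_self, mul_zero, Real.exp_zero]
    ring
  · simp only [hu, gfun_deriv]
    simp only [gfun, sub_self, mul_zero, Real.exp_zero]
    ring
  · simp only [hu, gfun_deriv]
    simp only [gfun, sub_self, mul_zero, Real.exp_zero]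
    ring
  · intro R hR
    obtain ⟨t, rfl⟩ : ∃ t, R = s + t := ⟨R - s, by ring⟩
    have ht : 0 < t := by linarith
    have hA := mul_pos (pow_pos hs 2) (coefA t ht)
    have hC := coefC t ht
    have hB : 0 ≤ 8 * s * t ^ 3 * (Real.exp (4 * t) - 1) := by
      have := Real.one_le_exp (show 0 ≤ 4 * t by linarith)
      have : 0 ≤ Real.exp (4 * t) - 1 := by linarith
      positivity
    simp only [u, add_sub_cancel_left]
    linarith
end
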